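/- Let C be a 2-category and W a class of 1-morphisms satisfying (BF1)–(BF5). Let Γ = [A³, v¹, v², α, β] be a 2-morphism of the bicategory of fractions between f¹ = (A¹, w¹, f¹) and f² = (A², w², f²). If β is invertible in C, then Γ is invertible in the bicategory of fractions, with vertical inverse [A³, v², v¹, α⁻¹, β⁻¹]. -/

import Mathlib

open CategoryTheory CategoryTheory.Bicategory

universe w v u


/-- Pronk's axioms (BF1)–(BF5) for a right bicalculus of fractions on a class `W`
of 1-morphisms of a bicategory. -/
structure PronkBF {B : Type u} [Bicategory.{w, v} B]
    (W : ∀ ⦃X Y : B⦄, (X ⟶ Y) → Prop) : Prop where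
  bf1 : ∀ X : B, W (𝟙 X)
  bf2 : ∀ {X Y Z : B} (f : X ⟶ Y) (g : Y ⟶ Z), W f → W g → W (f ≫ g)
  bf3 : ∀ {X Y Z : B} (wm : X ⟶ Y) (f : Z ⟶ Y), W wm →
      ∃ (D : B) (w' : D ⟶ Z) (f' : D ⟶ X), W w' ∧ Nonempty (w' ≫ f ≅ f' ≫ wm)
  bf4a : ∀ {X Y Z : B} (wm : Y ⟶ X) (f₁ f₂ : Z ⟶ Y) (α : f₁ ≫ wm ⟶ f₂ ≫ wm), W wm →
      ∃ (D : B) (vm : D ⟶ Z) (β : vm ≫ f₁ ⟶ vm ≫ f₂), W vm ∧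
        vm ◁ α = (α_ vm f₁ wm).inv ≫ β ▷ wm ≫ (α_ vm f₂ wm).hom
  bf4b : ∀ {X Y Z : B} (wm : Y ⟶ X) (f₁ f₂ : Z ⟶ Y) (α : f₁ ≫ wm ⟶ f₂ ≫ wm), W wm → IsIso α →
      ∃ (D : B) (vm : D ⟶ Z) (β : vm ≫ f₁ ⟶ vm ≫ f₂), W vm ∧ IsIso β ∧
        vm ◁ α = (α_ vm f₁ wm).inv ≫ β ▷ wm ≫ (α_ vm f₂ wm).hom
  bf4c : ∀ {X Y Z : B} (wm : Y ⟶ X) (f₁ f₂ : Z ⟶ Y) (α : f₁ ≫ wm ⟶ f₂ ≫ wm)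
      {D D' : B} (vm : D ⟶ Z) (β : vm ≫ f₁ ⟶ vm ≫ f₂)
      (vm' : D' ⟶ Z) (β' : vm' ≫ f₁ ⟶ vm' ≫ f₂),
      W wm → W vm → W vm' →
      (vm ◁ α = (α_ vm f₁ wm).inv ≫ β ▷ wm ≫ (α_ vm f₂ wm).hom) →
      (vm' ◁ α = (α_ vm' f₁ wm).inv ≫ β' ▷ wm ≫ (α_ vm' f₂ wm).hom) →
      ∃ (E : B) (um : E ⟶ D) (um' : E ⟶ D') (ζ : um ≫ vm ≅ um' ≫ vm'),
        W (um ≫ vm) ∧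
        ζ.hom ▷ f₁ ≫ (α_ um' vm' f₁).hom ≫ um' ◁ β' ≫ (α_ um' vm' f₂).inv
          = (α_ um vm f₁).hom ≫ um ◁ β ≫ (α_ um vm f₂).inv ≫ ζ.hom ▷ f₂
  bf5 : ∀ {X Y : B} (vm wm : X ⟶ Y), W wm → Nonempty (vm ≅ wm) → W vm
variable {B : Type u} [Bicategory.{w, v} B]

/-- The data of a representative of a 2-morphism in Pronk's bicategory of fractions:
a quintuple `(obj, v₁, v₂, α, β)`. -/
structure PronkSq {A Bb A₁ A₂ : B}
    (w₁ : A₁ ⟶ A) (f₁ : A₁ ⟶ Bb) (w₂ : A₂ ⟶ A) (f₂ : A₂ ⟶ Bb) where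
  obj : B
  v₁ : obj ⟶ A₁
  v₂ : obj ⟶ A₂
  α : v₁ ≫ w₁ ⟶ v₂ ≫ w₂
  β : v₁ ≫ f₁ ⟶ v₂ ≫ f₂

/-- Pronk's relation on quintuples representing 2-morphisms of the bicategory
of fractions. -/
def PronkRel (W : ∀ ⦃X Y : B⦄, (X ⟶ Y) → Prop) {A Bb A₁ A₂ : B}
    (w₁ : A₁ ⟶ A) (f₁ : A₁ ⟶ Bb) (w₂ : A₂ ⟶ A) (f₂ : A₂ ⟶ Bb)
    (Q Q' : PronkSq w₁ f₁ w₂ f₂) : Prop :=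
  ∃ (A₄ : B) (z : A₄ ⟶ Q.obj) (z' : A₄ ⟶ Q'.obj)
    (σ₁ : z' ≫ Q'.v₁ ≅ z ≫ Q.v₁) (σ₂ : z ≫ Q.v₂ ≅ z' ≫ Q'.v₂),
    W ((z ≫ Q.v₁) ≫ w₁) ∧
    (σ₁.hom ▷ w₁ ≫ (α_ z Q.v₁ w₁).hom ≫ z ◁ Q.α ≫ (α_ z Q.v₂ w₂).inv ≫ σ₂.hom ▷ w₂
       = (α_ z' Q'.v₁ w₁).hom ≫ z' ◁ Q'.α ≫ (α_ z' Q'.v₂ w₂).inv) ∧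
    (σ₁.hom ▷ f₁ ≫ (α_ z Q.v₁ f₁).hom ≫ z ◁ Q.β ≫ (α_ z Q.v₂ f₂).inv ≫ σ₂.hom ▷ f₂
       = (α_ z' Q'.v₁ f₁).hom ≫ z' ◁ Q'.β ≫ (α_ z' Q'.v₂ f₂).inv)
theorem pronk_faithful {B : Type u} [Bicategory.{w, v} B]
    (W : ∀ ⦃X Y : B⦄, (X ⟶ Y) → Prop) (hBF : PronkBF W)
    {X Y Z : B} (wm : Y ⟶ X) (hw : W wm) (f g : Z ⟶ Y) (β β' : f ⟶ g)
    (h : β ▷ wm = β' ▷ wm) :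
    ∃ (E : B) (m : E ⟶ Z), W m ∧ m ◁ β = m ◁ β' := by
  obtain ⟨E, um, um', ζ, hW, hζ⟩ := hBF.bf4c wm f g (β ▷ wm) (𝟙 Z) (𝟙 Z ◁ β) (𝟙 Z) (𝟙 Z ◁ β') hw
    (hBF.bf1 Z) (hBF.bf1 Z) (by simp) (by rw [h]; simp)
  refine ⟨E, um ≫ 𝟙 Z, hW, ?_⟩
  have h1 : ζ.hom ▷ f ≫ (um' ≫ 𝟙 Z) ◁ β' = (um ≫ 𝟙 Z) ◁ β ≫ ζ.hom ▷ g := by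
    simpa only [comp_whiskerLeft, Category.assoc] using hζ
  rw [← whisker_exchange] at h1
  exact ((cancel_mono _).1 h1).symm

theorem pronk_lift {B : Type u} [Bicategory.{w, v} B]
    (W : ∀ ⦃X Y : B⦄, (X ⟶ Y) → Prop) (hBF : PronkBF W)
    {A A₂ A₃ C : B} (w₂ : A₂ ⟶ A) (hw₂ : W w₂) (v₂ : A₃ ⟶ A₂) (hv : W (v₂ ≫ w₂))
    (t₁ t₂ : C ⟶ A₃) (ρ : t₁ ≫ v₂ ≅ t₂ ≫ v₂) :
    ∃ (D : B) (z : D ⟶ C) (τ : z ≫ t₁ ≅ z ≫ t₂), W z ∧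
      τ.hom ▷ v₂ = (α_ z t₁ v₂).hom ≫ z ◁ ρ.hom ≫ (α_ z t₂ v₂).inv := by
  obtain ⟨D, z, τ, hz, hτ, e⟩ := hBF.bf4b (v₂ ≫ w₂) t₁ t₂
    ((α_ t₁ v₂ w₂).inv ≫ ρ.hom ▷ w₂ ≫ (α_ t₂ v₂ w₂).hom) hv inferInstance
  obtain ⟨E, m, hm, e'⟩ := pronk_faithful W hBF w₂ hw₂ _ _ (τ ▷ v₂)
    ((α_ z t₁ v₂).hom ≫ z ◁ ρ.hom ≫ (α_ z t₂ v₂).inv) (by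
      have e2 : τ ▷ (v₂ ≫ w₂) = (α_ z t₁ (v₂ ≫ w₂)).hom ≫
        z ◁ ((α_ t₁ v₂ w₂).inv ≫ ρ.hom ▷ w₂ ≫ (α_ t₂ v₂ w₂).hom) ≫ (α_ z t₂ (v₂ ≫ w₂)).inv := by
        rw [e]; simp
      have e3 : (τ ▷ v₂) ▷ w₂ = (α_ _ _ _).hom ≫ τ ▷ (v₂ ≫ w₂) ≫ (α_ _ _ _).inv := by simp
      rw [e3, e2]
      simp)
  refine ⟨E, m ≫ z, (α_ _ _ _) ≪≫ whiskerLeftIso m (asIso τ) ≪≫ (α_ _ _ _).symm,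
    hBF.bf2 _ _ hm hz, ?_⟩
  have e4 : (((α_ m z t₁) ≪≫ whiskerLeftIso m (asIso τ) ≪≫ (α_ m z t₂).symm).hom) ▷ v₂
    = (α_ m z t₁).hom ▷ v₂ ≫ (α_ _ _ _).hom ≫ m ◁ (τ ▷ v₂) ≫ (α_ _ _ _).inv ≫
      (α_ m z t₂).inv ▷ v₂ := by simp
  rw [e4, e']
  simp

theorem pronk_cell {B : Type u} [Bicategory.{w, v} B]
    {A A₁ A₂ A₃ C D : B} (w₁ : A₁ ⟶ A) (w₂ : A₂ ⟶ A) (v₁ : A₃ ⟶ A₁) (v₂ : A₃ ⟶ A₂)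
    (a : v₁ ≫ w₁ ⟶ v₂ ≫ w₂) (b : v₂ ≫ w₂ ⟶ v₁ ≫ w₁) (hab : a ≫ b = 𝟙 _)
    (t₁ t₂ : C ⟶ A₃) (ρ : t₁ ≫ v₂ ≅ t₂ ≫ v₂) (z : D ⟶ C) (τ : z ≫ t₁ ≅ z ≫ t₂)
    (h : τ.hom ▷ v₂ = (α_ z t₁ v₂).hom ≫ z ◁ ρ.hom ≫ (α_ z t₂ v₂).inv) :
    z ◁ ((α_ t₁ v₁ w₁).hom ≫ t₁ ◁ a ≫ (α_ t₁ v₂ w₂).inv ≫ ρ.hom ▷ w₂ ≫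
            (α_ t₂ v₂ w₂).hom ≫ t₂ ◁ b ≫ (α_ t₂ v₁ w₁).inv) =
      (α_ z (t₁ ≫ v₁) w₁).inv ≫ ((α_ z t₁ v₁).inv ≫ τ.hom ▷ v₁ ≫ (α_ z t₂ v₁).hom) ▷ w₁ ≫
        (α_ z (t₂ ≫ v₁) w₁).hom := by
  have h2 : z ◁ ρ.hom = (α_ z t₁ v₂).inv ≫ τ.hom ▷ v₂ ≫ (α_ z t₂ v₂).hom := by
    rw [h]; simp
  have h3 : z ◁ ρ.hom ▷ w₂ = (α_ z (t₁ ≫ v₂) w₂).inv ≫ (z ◁ ρ.hom) ▷ w₂ ≫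
      (α_ z (t₂ ≫ v₂) w₂).hom := by simp
  have h4 : (z ≫ t₁) ◁ a ≫ τ.hom ▷ (v₂ ≫ w₂) ≫ (z ≫ t₂) ◁ b = τ.hom ▷ (v₁ ≫ w₁) := by
    rw [← Category.assoc, whisker_exchange, Category.assoc, ← whiskerLeft_comp, hab]; simp
  have h5 : τ.hom ▷ v₁ ▷ w₁ = (α_ _ _ _).hom ≫ τ.hom ▷ (v₁ ≫ w₁) ≫ (α_ _ _ _).inv := by simp
  simp only [whiskerLeft_comp, comp_whiskerRight]
  rw [h3, h2, h5, ← h4]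
  simp

theorem pronk_id_sq {B : Type u} [Bicategory.{w, v} B]
    {A A₁ C D : B} (w₁ : A₁ ⟶ A) (p q : C ⟶ A₁) (z : D ⟶ C) (Q : p ≫ w₁ ⟶ q ≫ w₁)
    (θ : z ≫ p ≅ z ≫ q)
    (h : z ◁ Q = (α_ z p w₁).inv ≫ θ.hom ▷ w₁ ≫ (α_ z q w₁).hom) :
    (ρ_ (z ≫ p)).hom ▷ w₁ ≫ (α_ z p w₁).hom ≫ z ◁ Q ≫ (α_ z q w₁).inv ≫
        (θ.symm ≪≫ (ρ_ (z ≫ p)).symm).hom ▷ w₁ =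
      (α_ (z ≫ p) (𝟙 A₁) w₁).hom ≫ (z ≫ p) ◁ (𝟙 (𝟙 A₁ ≫ w₁)) ≫
        (α_ (z ≫ p) (𝟙 A₁) w₁).inv := by
  rw [h]
  have : θ.hom ▷ w₁ ≫ θ.inv ▷ w₁ = 𝟙 _ := by rw [← comp_whiskerRight]; simp
  simp [reassoc_of% this]

theorem pronk_half {B : Type u} [Bicategory.{w, v} B]
    (W : ∀ ⦃X Y : B⦄, (X ⟶ Y) → Prop) (hBF : PronkBF W)
    {A Bb A₁ A₂ A₃ : B}
    (w₁ : A₁ ⟶ A) (f₁ : A₁ ⟶ Bb) (w₂ : A₂ ⟶ A) (f₂ : A₂ ⟶ Bb)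
    (hw₂ : W w₂)
    (v₁ : A₃ ⟶ A₁) (v₂ : A₃ ⟶ A₂) (hv : W (v₁ ≫ w₁)) (hv₂ : W (v₂ ≫ w₂))
    (a : v₁ ≫ w₁ ⟶ v₂ ≫ w₂) (a' : v₂ ≫ w₂ ⟶ v₁ ≫ w₁) (ha : a ≫ a' = 𝟙 _)
    (b : v₁ ≫ f₁ ⟶ v₂ ≫ f₂) (b' : v₂ ≫ f₂ ⟶ v₁ ≫ f₁) (hb : b ≫ b' = 𝟙 _)
    (C : B) (t₁ t₂ : C ⟶ A₃) (ht : W t₁) (ρ : t₁ ≫ v₂ ≅ t₂ ≫ v₂) :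
      PronkRel W w₁ f₁ w₁ f₁
        ⟨C, t₁ ≫ v₁, t₂ ≫ v₁,
          (α_ t₁ v₁ w₁).hom ≫ t₁ ◁ a ≫ (α_ t₁ v₂ w₂).inv ≫ ρ.hom ▷ w₂ ≫
            (α_ t₂ v₂ w₂).hom ≫ t₂ ◁ a' ≫ (α_ t₂ v₁ w₁).inv,
          (α_ t₁ v₁ f₁).hom ≫ t₁ ◁ b ≫ (α_ t₁ v₂ f₂).inv ≫ ρ.hom ▷ f₂ ≫
            (α_ t₂ v₂ f₂).hom ≫ t₂ ◁ b' ≫ (α_ t₂ v₁ f₁).inv⟩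
        ⟨A₁, 𝟙 A₁, 𝟙 A₁, 𝟙 (𝟙 A₁ ≫ w₁), 𝟙 (𝟙 A₁ ≫ f₁)⟩ := by
  obtain ⟨D, z, τ, hz, hτ⟩ := pronk_lift W hBF w₂ hw₂ v₂ hv₂ t₁ t₂ ρ
  let θ : z ≫ t₁ ≫ v₁ ≅ z ≫ t₂ ≫ v₁ :=
    (α_ z t₁ v₁).symm ≪≫ whiskerRightIso τ v₁ ≪≫ α_ z t₂ v₁
  refine ⟨D, z, z ≫ t₁ ≫ v₁, ρ_ (z ≫ t₁ ≫ v₁), θ.symm ≪≫ (ρ_ (z ≫ t₁ ≫ v₁)).symm, ?_, ?_, ?_⟩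
  · refine hBF.bf5 _ (z ≫ t₁ ≫ v₁ ≫ w₁) (hBF.bf2 _ _ hz (hBF.bf2 _ _ ht hv))
      ⟨α_ _ _ _ ≪≫ whiskerLeftIso z (α_ _ _ _)⟩
  · exact pronk_id_sq w₁ _ _ z _ θ (pronk_cell w₁ w₂ v₁ v₂ a a' ha t₁ t₂ ρ z τ hτ)
  · exact pronk_id_sq f₁ _ _ z _ θ (pronk_cell f₁ f₂ v₁ v₂ b b' hb t₁ t₂ ρ z τ hτ)

/-- if a representative quintuple of a 2-morphism of the bicategory of
fractions has invertible last component `β`, then it is invertible in the bicategory of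
fractions, with vertical inverse represented by `(A₃, v₂, v₁, α⁻¹, β⁻¹)`: both vertical
composites (computed from any admissible choice of auxiliary data) are equivalent to the
identity 2-morphism. -/
theorem statement10 {B : Type u} [Bicategory.{w, v} B] [Bicategory.Strict B]
    (W : ∀ ⦃X Y : B⦄, (X ⟶ Y) → Prop) (hBF : PronkBF W)
    {A Bb A₁ A₂ A₃ : B}
    (w₁ : A₁ ⟶ A) (f₁ : A₁ ⟶ Bb) (w₂ : A₂ ⟶ A) (f₂ : A₂ ⟶ Bb)
    (hw₁ : W w₁) (hw₂ : W w₂)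
    (v₁ : A₃ ⟶ A₁) (v₂ : A₃ ⟶ A₂) (hv : W (v₁ ≫ w₁))
    (α : v₁ ≫ w₁ ⟶ v₂ ≫ w₂) [IsIso α]
    (β : v₁ ≫ f₁ ⟶ v₂ ≫ f₂) [IsIso β] :
    (∀ (C : B) (t₁ t₂ : C ⟶ A₃), W t₁ → ∀ (ρ : t₁ ≫ v₂ ≅ t₂ ≫ v₂),
      PronkRel W w₁ f₁ w₁ f₁
        ⟨C, t₁ ≫ v₁, t₂ ≫ v₁,
          (α_ t₁ v₁ w₁).hom ≫ t₁ ◁ α ≫ (α_ t₁ v₂ w₂).inv ≫ ρ.hom ▷ w₂ ≫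
            (α_ t₂ v₂ w₂).hom ≫ t₂ ◁ inv α ≫ (α_ t₂ v₁ w₁).inv,
          (α_ t₁ v₁ f₁).hom ≫ t₁ ◁ β ≫ (α_ t₁ v₂ f₂).inv ≫ ρ.hom ▷ f₂ ≫
            (α_ t₂ v₂ f₂).hom ≫ t₂ ◁ inv β ≫ (α_ t₂ v₁ f₁).inv⟩
        ⟨A₁, 𝟙 A₁, 𝟙 A₁, 𝟙 (𝟙 A₁ ≫ w₁), 𝟙 (𝟙 A₁ ≫ f₁)⟩) ∧
    (∀ (C : B) (s₁ s₂ : C ⟶ A₃), W s₁ → ∀ (ρ' : s₁ ≫ v₁ ≅ s₂ ≫ v₁),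
      PronkRel W w₂ f₂ w₂ f₂
        ⟨C, s₁ ≫ v₂, s₂ ≫ v₂,
          (α_ s₁ v₂ w₂).hom ≫ s₁ ◁ inv α ≫ (α_ s₁ v₁ w₁).inv ≫ ρ'.hom ▷ w₁ ≫
            (α_ s₂ v₁ w₁).hom ≫ s₂ ◁ α ≫ (α_ s₂ v₂ w₂).inv,
          (α_ s₁ v₂ f₂).hom ≫ s₁ ◁ inv β ≫ (α_ s₁ v₁ f₁).inv ≫ ρ'.hom ▷ f₁ ≫
            (α_ s₂ v₁ f₁).hom ≫ s₂ ◁ β ≫ (α_ s₂ v₂ f₂).inv⟩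
        ⟨A₂, 𝟙 A₂, 𝟙 A₂, 𝟙 (𝟙 A₂ ≫ w₂), 𝟙 (𝟙 A₂ ≫ f₂)⟩) := by
  have hv₂ : W (v₂ ≫ w₂) := hBF.bf5 _ _ hv ⟨(asIso α).symm⟩
  refine ⟨fun C t₁ t₂ ht ρ => ?_, fun C s₁ s₂ hs ρ' => ?_⟩
  · exact pronk_half W hBF w₁ f₁ w₂ f₂ hw₂ v₁ v₂ hv hv₂ α (inv α) (by simp) β (inv β) (by simp)
      C t₁ t₂ ht ρ
  · exact pronk_half W hBF w₂ f₂ w₁ f₁ hw₁ v₂ v₁ hv₂ hv (inv α) α (by simp) (inv β) β (by simp)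
      C s₁ s₂ hs ρ'
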